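/- Let 2 ≤ t ≤ m−1. For each r ∈ V^t let G_r be a bold component of order t−1, and let g_r(x) = v_r + π(x) be an isometry of F^n preserving Ω(A^{t−1}), where the coordinate permutation π is the same for all r ∈ V^t and the set {r + v_r : r ∈ V^t} is an affine subspace of F^n (i.e., the collection {g_r} is degenerate). Then the set G = ∪_{r∈V^t}(r + g_r(G_r)) is not bold: its affine span ⟨G⟩ is a proper subset of B^t. -/

import Mathlib

open Finset Pointwise

abbrev Word (n : ℕ) := Fin n → ZMod 2

def FEv (n : ℕ) : Set (Word n) := {x | Even (hammingNorm x)}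

def FOd (n : ℕ) : Set (Word n) := {x | ¬ Even (hammingNorm x)}

def nbr {n : ℕ} (S : Set (Word n)) : Set (Word n) := {y | ∃ x ∈ S, hammingDist y x = 1}

def theta {n : ℕ} (G : Set (Word n)) : Set (Word n) :=
  {x | Even (hammingNorm x) ∧ nbr {x} ⊆ nbr G}

def ExtPerfect {n : ℕ} (C : Set (Word n)) : Prop :=
  C ⊆ FEv n ∧ (∀ x ∈ C, ∀ y ∈ C, x ≠ y → Disjoint (nbr {x}) (nbr {y})) ∧ nbr C = FOd n

def IsIsometry {n : ℕ} (g : Word n → Word n) : Prop :=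
  Function.Bijective g ∧ ∀ x y, hammingDist (g x) (g y) = hammingDist x y

def embWord (m t : ℕ) (v : Word (2 ^ (m - t))) : Word (2 ^ m) := fun i =>
  if h : (i : ℕ) < 2 ^ (m - t) then v ⟨i, h⟩
  else if h2 : (i : ℕ) < 2 * 2 ^ (m - t) then v ⟨(i : ℕ) - 2 ^ (m - t), by omega⟩
  else 0

def Vt (m t : ℕ) : Set (Word (2 ^ m)) :=
  {x | ∃ v : Word (2 ^ (m - t)), Even (hammingNorm v) ∧ x = embWord m t v}

def At (m : ℕ) : ℕ → Set (Word (2 ^ m))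
  | 0 => {0}
  | 1 => Vt m 1
  | t + 2 => Vt m (t + 2) + At m (t + 1)

def IsComp (m t : ℕ) (G : Set (Word (2 ^ m))) : Prop :=
  G ⊆ FEv (2 ^ m) ∧ G.ncard = (At m t).ncard ∧ nbr G = nbr (At m t)

def IsMuComp (m t : ℕ) (μ : Word (2 ^ m)) (M : Set (Word (2 ^ m))) : Prop :=
  (∀ i : Fin (2 ^ m), 2 ^ (m - t) ≤ (i : ℕ) → μ i = 0) ∧
  ∃ G, IsComp m t G ∧ M = (fun x => μ + x) '' G

def arrEntry (m t : ℕ) (x : Word (2 ^ m)) (i : Fin (2 ^ t)) (j : Fin (2 ^ (m - t))) : ZMod 2 :=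
  x ⟨((i : ℕ) * 2 ^ (m - t) + (j : ℕ)) % 2 ^ m, Nat.mod_lt _ (Nat.two_pow_pos m)⟩

def pchk (m t : ℕ) (x : Word (2 ^ m)) : Word (2 ^ (m - t)) :=
  fun j => ∑ i : Fin (2 ^ t), arrEntry m t x i j

def Bt (m : ℕ) : ℕ → Set (Word (2 ^ m))
  | 0 => Vt m 1
  | 1 => Vt m 1
  | t + 2 => Vt m (t + 2) + theta (At m (t + 1))

section ParityCheck

variable {m n : ℕ}

lemma even_hammingNorm_iff_sum_eq_zero (x : Word n) :
    Even (hammingNorm x) ↔ ∑ i, x i = 0 := by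
  have h : ∑ i, x i = (hammingNorm x : ZMod 2) := by
    have h2 : ∀ a : ZMod 2, a = if a ≠ 0 then 1 else 0 := by decide
    rw [Finset.sum_congr rfl fun i _ => h2 (x i), Finset.sum_boole]
    rfl
  rw [h, ZMod.natCast_eq_zero_iff_even]

lemma hammingDist_eq_one_iff (y x : Word n) :
    hammingDist y x = 1 ↔ ∃ i, y = x + Pi.single i 1 := by
  have hsub : ∀ a b : ZMod 2, a ≠ b ↔ a = b + 1 := by decide
  constructor
  · intro h
    obtain ⟨i, hi⟩ := Finset.card_eq_one.mp h
    refine ⟨i, funext fun k => ?_⟩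
    have hk : y k ≠ x k ↔ k = i := by
      simpa using Finset.ext_iff.mp hi k
    by_cases hki : k = i
    · subst hki
      simpa using (hsub _ _).mp (hk.mpr rfl)
    · simpa [hki] using hk
  · rintro ⟨i, rfl⟩
    refine Finset.card_eq_one.mpr ⟨i, Finset.ext fun k => ?_⟩
    by_cases hki : k = i
    · subst hki; simp
    · simp [hki]

lemma mem_nbr_iff (S : Set (Word n)) (y : Word n) :
    y ∈ nbr S ↔ ∃ x ∈ S, ∃ i, y = x + Pi.single i 1 := by
  simp only [nbr, Set.mem_ofPred_eq, hammingDist_eq_one_iff]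

lemma mem_theta_iff (S : Set (Word n)) (x : Word n) :
    x ∈ theta S ↔ ∑ i, x i = 0 ∧ ∀ i, x + Pi.single i 1 ∈ nbr S := by
  simp only [theta, Set.mem_ofPred_eq, even_hammingNorm_iff_sum_eq_zero, Set.subset_def,
    mem_nbr_iff {x}, Set.mem_singleton_iff, exists_eq_left, forall_exists_index,
    forall_eq_apply_imp_iff]

lemma sum_range_single {q j : ℕ} (hj : j < q) :
    ∑ k ∈ Finset.range q, (Pi.single j 1 : ℕ → ZMod 2) k = 1 := by
  simp [Pi.single_apply, hj]

/-- The parity check of order `s`: coordinates are summed over each residue class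
modulo `2 ^ (m - s)`. -/
def parity (m s : ℕ) : Word (2 ^ m) →ₗ[ZMod 2] (ℕ → ZMod 2) where
  toFun x j := ∑ i : Fin (2 ^ m), if (i : ℕ) % 2 ^ (m - s) = j then x i else 0
  map_add' x y := by
    ext j
    simp only [Pi.add_apply, ← Finset.sum_add_distrib]
    exact Finset.sum_congr rfl fun i _ => by split_ifs <;> simp
  map_smul' c x := by
    ext j
    simp only [Pi.smul_apply, smul_eq_mul, Finset.mul_sum, RingHom.id_apply]
    exact Finset.sum_congr rfl fun i _ => by split_ifs <;> simp

lemma parity_apply (s : ℕ) (x : Word (2 ^ m)) (j : ℕ) :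
    parity m s x j = ∑ i : Fin (2 ^ m), if (i : ℕ) % 2 ^ (m - s) = j then x i else 0 := rfl

lemma parity_single (s : ℕ) (i : Fin (2 ^ m)) :
    parity m s (Pi.single i 1) = Pi.single ((i : ℕ) % 2 ^ (m - s)) 1 := by
  ext j
  rw [parity_apply, Finset.sum_eq_single i]
  · simp [Pi.single_apply, eq_comm]
  · intro b _ hb; simp [hb]
  · simp

lemma parity_eq_zero_of_le (s : ℕ) (x : Word (2 ^ m)) {j : ℕ} (hj : 2 ^ (m - s) ≤ j) :
    parity m s x j = 0 := by
  rw [parity_apply]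
  refine Finset.sum_eq_zero fun i _ => if_neg fun h => ?_
  have := Nat.mod_lt (i : ℕ) (Nat.two_pow_pos (m - s))
  omega

lemma sum_parity (s : ℕ) (x : Word (2 ^ m)) :
    ∑ j ∈ Finset.range (2 ^ (m - s)), parity m s x j = ∑ i, x i := by
  simp only [parity_apply]
  rw [Finset.sum_comm]
  refine Finset.sum_congr rfl fun i _ => ?_
  rw [Finset.sum_ite_eq, if_pos]
  exact Finset.mem_range.mpr (Nat.mod_lt _ (Nat.two_pow_pos _))

lemma two_pow_sub_eq {s : ℕ} (hs : s < m) : 2 ^ (m - s) = 2 * 2 ^ (m - (s + 1)) := by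
  rw [← pow_succ']; congr 1; omega

lemma parity_succ {s : ℕ} (hs : s < m) (x : Word (2 ^ m)) {j : ℕ}
    (hj : j < 2 ^ (m - (s + 1))) :
    parity m (s + 1) x j = parity m s x j + parity m s x (j + 2 ^ (m - (s + 1))) := by
  simp only [parity_apply, ← Finset.sum_add_distrib]
  refine Finset.sum_congr rfl fun i _ => ?_
  rw [two_pow_sub_eq hs]
  generalize 2 ^ (m - (s + 1)) = q at *
  have h1 : (i : ℕ) % (2 * q) % q = i % q := Nat.mod_mul_left_mod _ _ _
  have h2 : (i : ℕ) % (2 * q) < 2 * q := Nat.mod_lt _ (by omega)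
  generalize (i : ℕ) % (2 * q) = a at *
  rw [← h1]
  rcases lt_or_ge a q with h | h
  · rw [Nat.mod_eq_of_lt h, if_neg (show ¬ a = j + q by omega), add_zero]
  · have : a % q = a - q := by
      rw [Nat.mod_eq_sub_mod h, Nat.mod_eq_of_lt (by omega)]
    rw [this, if_neg (show ¬ a = j by omega), zero_add]
    exact if_congr (by omega) rfl rfl

lemma parity_of_support (s : ℕ) (x : Word (2 ^ m))
    (hx : ∀ i : Fin (2 ^ m), 2 ^ (m - s) ≤ (i : ℕ) → x i = 0) (i : Fin (2 ^ m))
    (hi : (i : ℕ) < 2 ^ (m - s)) : parity m s x i = x i := by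
  rw [parity_apply, Finset.sum_eq_single i]
  · rw [if_pos (Nat.mod_eq_of_lt hi)]
  · intro b _ hb
    split_ifs with h
    · refine hx b (not_lt.mp fun hlt => hb (Fin.ext ?_))
      rwa [Nat.mod_eq_of_lt hlt] at h
    · rfl
  · simp

lemma mem_Vt_iff {s : ℕ} (hs : s < m) (x : Word (2 ^ m)) :
    x ∈ Vt m (s + 1) ↔ ∃ w : ℕ → ZMod 2, ∑ j ∈ Finset.range (2 ^ (m - (s + 1))), w j = 0 ∧
      ∀ i : Fin (2 ^ m), x i =
        if (i : ℕ) < 2 ^ (m - s) then w (i % 2 ^ (m - (s + 1))) else 0 := by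
  have key : ∀ (v : Word (2 ^ (m - (s + 1)))) (w : ℕ → ZMod 2), (∀ i, v i = w i) →
      ∀ i : Fin (2 ^ m), embWord m (s + 1) v i =
        if (i : ℕ) < 2 ^ (m - s) then w (i % 2 ^ (m - (s + 1))) else 0 := by
    intro v w hvw i
    rw [two_pow_sub_eq hs]
    unfold embWord
    simp only [hvw]
    generalize 2 ^ (m - (s + 1)) = q at *
    split_ifs with h1 h2 h2
    · rw [Nat.mod_eq_of_lt h1]
    · omega
    · rw [Nat.mod_eq_sub_mod (by omega), Nat.mod_eq_of_lt (by omega)]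
    · rfl
  constructor
  · rintro ⟨v, hv, rfl⟩
    obtain ⟨w, hvw⟩ : ∃ w : ℕ → ZMod 2, ∀ i, v i = w i :=
      ⟨fun j => if h : j < 2 ^ (m - (s + 1)) then v ⟨j, h⟩ else 0, fun i => by simp⟩
    refine ⟨w, ?_, key v w hvw⟩
    rw [even_hammingNorm_iff_sum_eq_zero] at hv
    rw [Finset.sum_range, ← hv]
    exact Finset.sum_congr rfl fun i _ => (hvw i).symm
  · rintro ⟨w, hw, hx⟩
    refine ⟨fun i => w i, ?_, funext fun i => ?_⟩
    · rw [even_hammingNorm_iff_sum_eq_zero, ← hw, Finset.sum_range]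
    · rw [hx, key _ w fun _ => rfl]

lemma parity_Vt {s : ℕ} {x : Word (2 ^ m)} {w : ℕ → ZMod 2}
    (hx : ∀ i : Fin (2 ^ m), x i =
      if (i : ℕ) < 2 ^ (m - s) then w (i % 2 ^ (m - (s + 1))) else 0)
    {j : ℕ} (hj : j < 2 ^ (m - s)) :
    parity m s x j = w (j % 2 ^ (m - (s + 1))) := by
  have hle : 2 ^ (m - s) ≤ 2 ^ m := Nat.pow_le_pow_right two_pos (Nat.sub_le _ _)
  have := parity_of_support s x (fun i hi => by rw [hx, if_neg (by omega)]) ⟨j, by omega⟩ hj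
  rw [this, hx, if_pos hj]

/-- `Vt m (s + 1)` as a linear subspace. -/
def VtSubmodule {s : ℕ} (hs : s < m) : Submodule (ZMod 2) (Word (2 ^ m)) where
  carrier := Vt m (s + 1)
  zero_mem' := (mem_Vt_iff hs 0).mpr ⟨0, by simp, by simp⟩
  add_mem' {x y} hx hy := by
    obtain ⟨w, hw, hx⟩ := (mem_Vt_iff hs x).mp hx
    obtain ⟨u, hu, hy⟩ := (mem_Vt_iff hs y).mp hy
    refine (mem_Vt_iff hs _).mpr ⟨w + u, ?_, fun i => ?_⟩
    · simp [Finset.sum_add_distrib, hw, hu]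
    · rw [Pi.add_apply, hx, hy]; split_ifs <;> simp
  smul_mem' c x hx := by
    obtain ⟨w, hw, hx⟩ := (mem_Vt_iff hs x).mp hx
    refine (mem_Vt_iff hs _).mpr ⟨c • w, ?_, fun i => ?_⟩
    · simp [← Finset.mul_sum, hw]
    · rw [Pi.smul_apply, hx]; split_ifs <;> simp

lemma At_succ (s : ℕ) : At m (s + 1) = Vt m (s + 1) + At m s := by
  cases s with
  | zero => simp [At]
  | succ s => rfl

lemma parity_eq_zero_of_mem_At {s : ℕ} (hs : s ≤ m) {x : Word (2 ^ m)} (hx : x ∈ At m s) :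
    parity m s x = 0 := by
  induction s generalizing x with
  | zero =>
    have : x = 0 := hx
    rw [this, map_zero]
  | succ s ih =>
    rw [At_succ] at hx
    obtain ⟨r, hr, a, ha, rfl⟩ := Set.mem_add.mp hx
    obtain ⟨w, -, hw⟩ := (mem_Vt_iff hs r).mp hr
    ext j
    rcases lt_or_ge j (2 ^ (m - (s + 1))) with hj | hj
    · have h2 := two_pow_sub_eq hs
      rw [parity_succ hs _ hj, map_add, ih (by omega) ha, add_zero,
        parity_Vt hw (by omega), parity_Vt hw (by omega), Nat.add_mod_right,
        CharTwo.add_self_eq_zero]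
      rfl
    · exact parity_eq_zero_of_le _ _ hj

lemma mem_nbr_At_of_parity {s : ℕ} (hs : s ≤ m) {y : Word (2 ^ m)} {j : ℕ}
    (hj : j < 2 ^ (m - s)) (hy : parity m s y = Pi.single j 1) : y ∈ nbr (At m s) := by
  induction s generalizing y j with
  | zero =>
    refine (mem_nbr_iff _ _).mpr ⟨0, rfl, ⟨j, hj⟩, funext fun i => ?_⟩
    have := parity_of_support 0 y (fun i hi => absurd i.isLt (not_lt.mpr hi)) i (by simp)
    rw [← this, hy, zero_add]
    simp [Pi.single_apply, Fin.ext_iff]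
  | succ s ih =>
    have h2 := two_pow_sub_eq hs
    set q := 2 ^ (m - (s + 1))
    have hsplit : ∀ k < q, parity m s y k + parity m s y (k + q) =
        (Pi.single j 1 : ℕ → ZMod 2) k := by
      intro k hk; rw [← hy, parity_succ hs _ hk]
    suffices h : ∃ w : ℕ → ZMod 2, ∑ k ∈ Finset.range q, w k = 0 ∧ ∃ l < 2 ^ (m - s),
        ∀ k < 2 ^ (m - s), parity m s y k + w (k % q) = (Pi.single l 1 : ℕ → ZMod 2) k by
      obtain ⟨w, hw, l, hl, h⟩ := h
      let r : Word (2 ^ m) := fun i => if (i : ℕ) < 2 ^ (m - s) then w (i % q) else 0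
      have hr : r ∈ Vt m (s + 1) := (mem_Vt_iff hs r).mpr ⟨w, hw, fun _ => rfl⟩
      have hpar : parity m s (y + r) = Pi.single l 1 := by
        ext k
        rcases lt_or_ge k (2 ^ (m - s)) with hk | hk
        · rw [map_add, Pi.add_apply, parity_Vt (fun _ => rfl) hk]
          exact h k hk
        · rw [parity_eq_zero_of_le _ _ hk, Pi.single_eq_of_ne (by omega)]
      obtain ⟨a, ha, i, hi⟩ := (mem_nbr_iff _ _).mp (ih (by omega) hl hpar)
      refine (mem_nbr_iff _ _).mpr ⟨r + a, ?_, i, ?_⟩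
      · rw [At_succ]; exact Set.add_mem_add hr ha
      · rw [add_assoc, ← hi, add_comm y r, ← add_assoc, CharTwo.add_self_eq_zero, zero_add]
    have hsum : ∑ k ∈ Finset.range q, parity m s y k +
        ∑ k ∈ Finset.range q, parity m s y (k + q) = 1 := by
      rw [← Finset.sum_add_distrib, Finset.sum_congr rfl fun k hk =>
        hsplit k (Finset.mem_range.mp hk)]
      exact sum_range_single hj
    have hmod : ∀ k, q ≤ k → k < 2 ^ (m - s) → k % q = k - q := fun k h h' => by
      rw [Nat.mod_eq_sub_mod h, Nat.mod_eq_of_lt (by omega)]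
    have hcases : ∀ a b : ZMod 2, a + b = 1 → a = 0 ∨ b = 0 := by decide
    rcases hcases _ _ hsum with h0 | h0
    · refine ⟨fun k => parity m s y k, h0, j + q, by omega, fun k hk => ?_⟩
      rcases lt_or_ge k q with hkq | hkq
      · rw [Nat.mod_eq_of_lt hkq, Pi.single_eq_of_ne (by omega), CharTwo.add_self_eq_zero]
      · have h := hsplit (k - q) (by omega)
        rw [Nat.sub_add_cancel hkq, add_comm] at h
        rw [hmod k hkq hk, h]
        simp only [Pi.single_apply]
        exact if_congr (by omega) rfl rfl
    · refine ⟨fun k => parity m s y (k + q), h0, j, by omega, fun k hk => ?_⟩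
      rcases lt_or_ge k q with hkq | hkq
      · rw [Nat.mod_eq_of_lt hkq, hsplit k hkq]
      · dsimp only
        rw [hmod k hkq hk, Nat.sub_add_cancel hkq, CharTwo.add_self_eq_zero,
          Pi.single_eq_of_ne (by omega)]

lemma mem_nbr_At_iff {s : ℕ} (hs : s ≤ m) (y : Word (2 ^ m)) :
    y ∈ nbr (At m s) ↔ ∃ j < 2 ^ (m - s), parity m s y = Pi.single j 1 := by
  refine ⟨fun hy => ?_, fun ⟨j, hj, hy⟩ => mem_nbr_At_of_parity hs hj hy⟩
  obtain ⟨a, ha, i, rfl⟩ := (mem_nbr_iff _ _).mp hy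
  exact ⟨_, Nat.mod_lt i (Nat.two_pow_pos _), by
    rw [map_add, parity_eq_zero_of_mem_At hs ha, parity_single, zero_add]⟩

lemma sum_eq_one_of_mem_nbr_At {s : ℕ} (hs : s ≤ m) {y : Word (2 ^ m)}
    (hy : y ∈ nbr (At m s)) : ∑ i, y i = 1 := by
  obtain ⟨j, hj, h⟩ := (mem_nbr_At_iff hs y).mp hy
  rw [← sum_parity s, h, sum_range_single hj]

lemma theta_At {s : ℕ} (hs : s + 2 ≤ m) :
    theta (At m s) = (LinearMap.ker (parity m s) : Set (Word (2 ^ m))) := by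
  have hq : 4 ≤ 2 ^ (m - s) := Nat.pow_le_pow_right two_pos (show 2 ≤ m - s by omega)
  have hle : 2 ^ (m - s) ≤ 2 ^ m := Nat.pow_le_pow_right two_pos (Nat.sub_le _ _)
  ext x
  simp only [mem_theta_iff, SetLike.mem_coe, LinearMap.mem_ker]
  constructor
  · rintro ⟨-, h⟩
    have hi : ∀ k < 2 ^ (m - s), ∃ j, parity m s x = Pi.single j 1 + Pi.single k 1 := by
      intro k hk
      obtain ⟨j, -, hj⟩ := (mem_nbr_At_iff (by omega) _).mp (h ⟨k, by omega⟩)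
      rw [map_add, parity_single, Nat.mod_eq_of_lt hk] at hj
      refine ⟨j, ?_⟩
      rw [← hj, add_assoc, CharTwo.add_self_eq_zero, add_zero]
    obtain ⟨j, hj⟩ := hi 0 (by omega)
    by_cases hj0 : j = 0
    · rw [hj, hj0, CharTwo.add_self_eq_zero]
    · exfalso
      obtain ⟨k, hk, hk0, hkj⟩ : ∃ k < 2 ^ (m - s), k ≠ 0 ∧ k ≠ j := by
        by_cases h1 : j = 1
        · exact ⟨2, by omega, by omega, by omega⟩
        · exact ⟨1, by omega, by omega, by omega⟩
      obtain ⟨l, hl⟩ := hi k hk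
      rw [hj] at hl
      have e0 := congrFun hl 0
      have ej := congrFun hl j
      simp only [Pi.add_apply, Pi.single_apply, hj0, hk0.symm, hkj.symm, if_true, if_false,
        Ne.symm hj0, zero_add, add_zero] at e0 ej
      have hl0 : 0 = l := by by_contra h; simp [h] at e0
      have hlj : j = l := by by_contra h; simp [h] at ej
      omega
  · intro hx
    refine ⟨by rw [← sum_parity s, hx]; simp, fun i => ?_⟩
    refine (mem_nbr_At_iff (by omega) _).mpr ⟨_, Nat.mod_lt i (Nat.two_pow_pos _), ?_⟩
    rw [map_add, hx, parity_single, zero_add]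

lemma Bt_succ {s : ℕ} (hs : s + 2 ≤ m) :
    Bt m (s + 1) = ((VtSubmodule (show s < m by omega) ⊔ LinearMap.ker (parity m s) :
      Submodule (ZMod 2) (Word (2 ^ m))) : Set (Word (2 ^ m))) := by
  rw [Submodule.coe_sup, ← theta_At hs]
  cases s with
  | zero =>
    have h0 : theta (At m 0) = {0} := by
      rw [theta_At hs]
      ext x
      simp only [SetLike.mem_coe, LinearMap.mem_ker, Set.mem_singleton_iff]
      refine ⟨fun hx => funext fun i => ?_, fun hx => by rw [hx, map_zero]⟩
      rw [← parity_of_support 0 x (fun i hi => absurd i.isLt (not_lt.mpr hi)) i (by simp), hx]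
      rfl
    rw [h0, Set.add_singleton]
    simp [Bt, VtSubmodule]
  | succ s => rfl

/-- Half of the order-`s` parity checks sum to zero on `Bt m (s + 1)`. -/
lemma sum_parity_eq_zero_of_mem_Bt {s : ℕ} (hs : s + 2 ≤ m) {x : Word (2 ^ m)}
    (hx : x ∈ Bt m (s + 1)) :
    ∑ j ∈ Finset.range (2 ^ (m - (s + 1))), parity m s x j = 0 := by
  have hsm : s < m := by omega
  rw [Bt_succ hs] at hx
  obtain ⟨r, hr, k, hk, rfl⟩ := Submodule.mem_sup.mp hx
  obtain ⟨w, hw, hr⟩ := (mem_Vt_iff hsm r).mp hr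
  rw [map_add, LinearMap.mem_ker.mp hk, add_zero, ← hw]
  refine Finset.sum_congr rfl fun j hj => ?_
  have hj := Finset.mem_range.mp hj
  rw [parity_Vt hr (by rw [two_pow_sub_eq hsm]; omega), Nat.mod_eq_of_lt hj]

lemma exists_mem_ker_parity_notMem_Bt {s : ℕ} (hs : s + 2 ≤ m) :
    ∃ x ∈ LinearMap.ker (parity m (s + 1)), x ∉ Bt m (s + 1) := by
  have h2 := two_pow_sub_eq (show s < m by omega)
  have hle : 2 ^ (m - s) ≤ 2 ^ m := Nat.pow_le_pow_right two_pos (Nat.sub_le _ _)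
  have hpos := Nat.two_pow_pos (m - (s + 1))
  refine ⟨Pi.single ⟨0, by omega⟩ 1 + Pi.single ⟨2 ^ (m - (s + 1)), by omega⟩ 1, ?_, fun h => ?_⟩
  · rw [LinearMap.mem_ker, map_add, parity_single, parity_single]
    simp [CharTwo.add_self_eq_zero]
  · have := sum_parity_eq_zero_of_mem_Bt hs h
    rw [map_add, parity_single, parity_single, Nat.zero_mod,
      Nat.mod_eq_of_lt (show 2 ^ (m - (s + 1)) < 2 ^ (m - s) by omega)] at this
    simp [Finset.sum_add_distrib, Pi.single_apply] at this

lemma disjoint_VtSubmodule_ker_parity {s : ℕ} (hs : s < m) :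
    Disjoint (VtSubmodule hs) (LinearMap.ker (parity m s)) := by
  rw [Submodule.disjoint_def]
  intro x hx hk
  obtain ⟨w, -, hw⟩ := (mem_Vt_iff hs x).mp hx
  ext i
  rcases lt_or_ge (i : ℕ) (2 ^ (m - s)) with hi | hi
  · rw [← parity_of_support s x (fun i hi => by rw [hw, if_neg (by omega)]) i hi,
      LinearMap.mem_ker.mp hk]
    rfl
  · rw [hw, if_neg (by omega)]
    rfl

/-- The isometry `x ↦ v + π x` preserving the neighborhood of `At m s` preserves `theta`. -/
lemma isometry_mem_theta {s : ℕ} (hs : s ≤ m) {v : Word (2 ^ m)} {π : Equiv.Perm (Fin (2 ^ m))}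
    (h : (fun x : Word (2 ^ m) => v + fun i => x (π i)) '' nbr (At m s) = nbr (At m s))
    {x : Word (2 ^ m)} (hx : x ∈ theta (At m s)) :
    (v + fun i => x (π i)) ∈ theta (At m s) := by
  obtain ⟨hx0, hx⟩ := (mem_theta_iff _ _).mp hx
  have hsum : ∀ y : Word (2 ^ m), ∑ i, (v + fun i => y (π i)) i = ∑ i, v i + ∑ i, y i := by
    intro y
    simp only [Pi.add_apply, Finset.sum_add_distrib]
    rw [Equiv.sum_comp π y]
  have hv : ∑ i, v i = 0 := by
    have hy := hx ⟨0, Nat.two_pow_pos m⟩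
    have h1 := sum_eq_one_of_mem_nbr_At hs (h ▸ Set.mem_image_of_mem _ hy)
    rwa [hsum, sum_eq_one_of_mem_nbr_At hs hy, add_eq_right] at h1
  refine (mem_theta_iff _ _).mpr ⟨by rw [hsum, hv, hx0, add_zero], fun i => ?_⟩
  rw [← h]
  refine ⟨_, hx (π i), ?_⟩
  ext k
  simp [Pi.single_apply, add_assoc]

/-- The sum of an affine subspace and a linear subspace. -/
def affineAdd {k V : Type*} [Ring k] [AddCommGroup V] [Module k V] (S : AffineSubspace k V)
    (W : Submodule k V) : AffineSubspace k V where
  carrier := (S : Set V) + (W : Set V)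
  smul_vsub_vadd_mem' := by
    rintro c _ _ _ ⟨s₁, h₁, b₁, k₁, rfl⟩ ⟨s₂, h₂, b₂, k₂, rfl⟩ ⟨s₃, h₃, b₃, k₃, rfl⟩
    refine ⟨_, S.smul_vsub_vadd_mem c h₁ h₂ h₃, _,
      W.add_mem (W.smul_mem c (W.sub_mem k₁ k₂)) k₃, ?_⟩
    simp only [vsub_eq_sub, vadd_eq_add, smul_sub, smul_add]
    abel

end ParityCheck

/-- a degenerate collection of local automorphisms applied to bold components
of order t-1 produces a non-bold set: its affine span is a proper subset of B^t. -/
theorem stmt_16 (m t : ℕ) (hm : 4 ≤ m) (ht : 2 ≤ t) (ht' : t ≤ m - 1)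
    (Gr : Word (2 ^ m) → Set (Word (2 ^ m)))
    (hGr : ∀ r ∈ Vt m t, IsComp m (t - 1) (Gr r) ∧
      (affineSpan (ZMod 2) (Gr r) : Set (Word (2 ^ m))) = Bt m (t - 1))
    (v : Word (2 ^ m) → Word (2 ^ m)) (π : Equiv.Perm (Fin (2 ^ m)))
    (hloc : ∀ r ∈ Vt m t,
      (fun x : Word (2 ^ m) => v r + fun i => x (π i)) '' nbr (At m (t - 1))
        = nbr (At m (t - 1)))
    (haff : (affineSpan (ZMod 2) ((fun r => r + v r) '' Vt m t) : Set (Word (2 ^ m)))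
        = (fun r => r + v r) '' Vt m t) :
    (affineSpan (ZMod 2)
        (⋃ r ∈ Vt m t,
          (fun y => r + y) '' ((fun x : Word (2 ^ m) => v r + fun i => x (π i)) '' Gr r))
      : Set (Word (2 ^ m))) ⊂ Bt m t := by
  obtain ⟨s, rfl⟩ : ∃ s, t = s + 2 := ⟨t - 2, by omega⟩
  simp only [show s + 2 - 1 = s + 1 from rfl] at hGr hloc
  have hs : s + 1 < m := by omega
  have hs' : s + 1 + 2 ≤ m := by omega
  set K := LinearMap.ker (parity m (s + 1))
  have hKtheta : theta (At m (s + 1)) = (K : Set (Word (2 ^ m))) := theta_At hs'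
  have hGK : ∀ r ∈ Vt m (s + 2), Gr r ⊆ (K : Set (Word (2 ^ m))) := by
    intro r hr x hx
    obtain ⟨⟨hev, -, hnbr⟩, -⟩ := hGr r hr
    rw [← hKtheta, mem_theta_iff]
    exact ⟨(even_hammingNorm_iff_sum_eq_zero x).mp (hev hx), fun i =>
      hnbr ▸ (mem_nbr_iff _ _).mpr ⟨x, hx, i, rfl⟩⟩
  let B := VtSubmodule (show s < m by omega) ⊔ LinearMap.ker (parity m s)
  have hBt : Bt m (s + 1) = (B : Set (Word (2 ^ m))) := Bt_succ (by omega)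
  have hBK : B < K := by
    have h0 : (0 : Word (2 ^ m)) ∈ Vt m (s + 2) := (VtSubmodule hs).zero_mem
    refine SetLike.lt_iff_le_and_exists.mpr ⟨?_, ?_⟩
    · rw [← SetLike.coe_subset_coe, ← hBt, ← (hGr 0 h0).2]
      exact affineSpan_le (Q := K.toAffineSubspace).mpr (hGK 0 h0)
    · obtain ⟨x, hx, hxB⟩ := exists_mem_ker_parity_notMem_Bt (m := m) (s := s) (by omega)
      exact ⟨x, hx, by rwa [hBt] at hxB⟩
  have hBt' : Bt m (s + 2) = ((VtSubmodule hs ⊔ K : Submodule _ _) : Set (Word (2 ^ m))) :=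
    Bt_succ hs'
  have hsub : (affineSpan (ZMod 2) (⋃ r ∈ Vt m (s + 2), (fun y => r + y) ''
      ((fun x : Word (2 ^ m) => v r + fun i => x (π i)) '' Gr r)) : Set (Word (2 ^ m))) ⊆
      Bt m (s + 2) := by
    rw [hBt']
    refine affineSpan_le (Q := (VtSubmodule hs ⊔ K).toAffineSubspace).mpr ?_
    refine Set.iUnion₂_subset fun r hr => ?_
    rintro _ ⟨_, ⟨x, hx, rfl⟩, rfl⟩
    refine Submodule.add_mem_sup (show r ∈ VtSubmodule hs from hr) ?_
    have hmem := isometry_mem_theta hs.le (hloc r hr) (hKtheta ▸ hGK r hr hx)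
    rwa [hKtheta] at hmem
  refine hsub.ssubset_of_ne fun heq => ?_
  let P : Word (2 ^ m) →ₗ[ZMod 2] Word (2 ^ m) := LinearMap.funLeft (ZMod 2) (ZMod 2) π
  have hle : Bt m (s + 2) ⊆ ((fun r => r + v r) '' Vt m (s + 2)) + P '' (B : Set (Word (2 ^ m))) := by
    rw [← heq, ← haff]
    refine affineSpan_le (Q := affineAdd _ (B.map P)).mpr ?_
    refine Set.iUnion₂_subset fun r hr => ?_
    rintro _ ⟨_, ⟨x, hx, rfl⟩, rfl⟩
    refine ⟨r + v r, subset_affineSpan _ _ ⟨r, hr, rfl⟩, P x, ⟨x, ?_, rfl⟩, add_assoc _ _ _⟩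
    rw [← hBt, ← (hGr r hr).2]
    exact subset_affineSpan _ _ hx
  have hcard := Set.ncard_le_ncard hle (Set.toFinite _)
  have hlt : (B : Set (Word (2 ^ m))).ncard < (K : Set (Word (2 ^ m))).ncard :=
    Set.ncard_lt_ncard (SetLike.coe_ssubset_coe.mpr hBK) (Set.toFinite _)
  have hVpos : 0 < (Vt m (s + 2)).ncard :=
    (Set.ncard_pos (Set.toFinite _)).mpr ⟨0, (VtSubmodule hs).zero_mem⟩
  have hsumset : (Bt m (s + 2)).ncard = (Vt m (s + 2)).ncard * (K : Set (Word (2 ^ m))).ncard := by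
    rw [hBt', Submodule.coe_sup, ← Set.image2_add, ← Set.image_prod, ← Set.ncard_prod]
    refine Set.InjOn.ncard_image ?_
    rintro ⟨a, b⟩ ⟨ha, hb⟩ ⟨c, d⟩ ⟨hc, hd⟩ h
    have := Submodule.disjoint_def.mp (disjoint_VtSubmodule_ker_parity hs) (a - c)
      (Submodule.sub_mem _ ha hc) (by
        have : a - c = d - b := by
          rw [sub_eq_sub_iff_add_eq_add, add_comm d c]; exact h
        rw [this]; exact Submodule.sub_mem _ hd hb)
    have hac : a = c := sub_eq_zero.mp this
    subst hac
    exact Prod.ext rfl (add_left_cancel h)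
  have hupper : (((fun r => r + v r) '' Vt m (s + 2)) + P '' (B : Set (Word (2 ^ m)))).ncard ≤
      (Vt m (s + 2)).ncard * (B : Set (Word (2 ^ m))).ncard := by
    rw [← Set.image2_add, ← Set.image_prod]
    refine (Set.ncard_image_le (Set.toFinite _)).trans ?_
    rw [Set.ncard_prod]
    exact Nat.mul_le_mul (Set.ncard_image_le (Set.toFinite _)) (Set.ncard_image_le (Set.toFinite _))
  have := Nat.mul_lt_mul_of_pos_left hlt hVpos
  omega
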